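/- Let ψ be a unit vector in ℂ²⊗ℂ²⊗ℂ² (a pure three-qubit state with density matrix ρ_ABC = |ψ⟩⟨ψ|). Then for every choice of orthonormal measurement bases (on B and on AB), the residual correlation function is nonnegative: D_RC(A:B:C) ≥ 0. -/

import Mathlib

open scoped BigOperators ComplexOrder
open Matrix

noncomputable section

abbrev Q2 := Fin 2
abbrev Q4 := Fin 2 × Fin 2
abbrev Q3 := Fin 2 × Fin 2 × Fin 2

/-- A density matrix: positive semidefinite (hence Hermitian) with unit trace. -/
def IsDensityMatrix {n : Type*} [Fintype n] [DecidableEq n] (ρ : Matrix n n ℂ) : Prop :=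
  ρ.PosSemidef ∧ ρ.trace = 1

/-- Von Neumann entropy `S(ρ) = -∑ λᵢ log λᵢ` (eigenvalues of a Hermitian matrix),
with the convention `0 log 0 = 0`. -/
noncomputable def vN {n : Type*} [Fintype n] [DecidableEq n] (ρ : Matrix n n ℂ) : ℝ :=
  if h : ρ.IsHermitian then ∑ i, Real.negMulLog (h.eigenvalues i) else 0

/-- Rank-one projector `|u⟩⟨u|`. -/
def proj {n : Type*} (u : n → ℂ) : Matrix n n ℂ := fun i j => u i * star (u j)

/-- An orthonormal family of vectors (an orthonormal basis when `card ι = card n`). -/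
def OrthonormalFamily {ι n : Type*} [DecidableEq ι] [Fintype n] (u : ι → n → ℂ) : Prop :=
  ∀ i j, (∑ k, star (u i k) * u j k) = if i = j then (1 : ℂ) else 0

/-- A unit vector. -/
def IsUnitVec {n : Type*} [Fintype n] (u : n → ℂ) : Prop :=
  (∑ k, star (u k) * u k) = 1

/-- Reduced state of subsystem A. -/
def rhoA (ρ : Matrix Q3 Q3 ℂ) : Matrix Q2 Q2 ℂ := fun a a' => ∑ b, ∑ c, ρ (a, b, c) (a', b, c)
/-- Reduced state of subsystem B. -/
def rhoB (ρ : Matrix Q3 Q3 ℂ) : Matrix Q2 Q2 ℂ := fun b b' => ∑ a, ∑ c, ρ (a, b, c) (a, b', c)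
/-- Reduced state of subsystem C. -/
def rhoC (ρ : Matrix Q3 Q3 ℂ) : Matrix Q2 Q2 ℂ := fun c c' => ∑ a, ∑ b, ρ (a, b, c) (a, b, c')
/-- Reduced state of subsystems AB. -/
def rhoAB (ρ : Matrix Q3 Q3 ℂ) : Matrix Q4 Q4 ℂ := fun x y => ∑ c, ρ (x.1, x.2, c) (y.1, y.2, c)
/-- Reduced state of subsystems BC. -/
def rhoBC (ρ : Matrix Q3 Q3 ℂ) : Matrix Q4 Q4 ℂ := fun x y => ∑ a, ρ (a, x.1, x.2) (a, y.1, y.2)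
/-- Reduced state of subsystems AC. -/
def rhoAC (ρ : Matrix Q3 Q3 ℂ) : Matrix Q4 Q4 ℂ := fun x y => ∑ b, ρ (x.1, b, x.2) (y.1, b, y.2)

/-- `I ⊗ π ⊗ I`: an operator acting on subsystem B only. -/
def opB (π : Matrix Q2 Q2 ℂ) : Matrix Q3 Q3 ℂ :=
  fun x y => (if x.1 = y.1 then (1 : ℂ) else 0) * π x.2.1 y.2.1 *
    (if x.2.2 = y.2.2 then (1 : ℂ) else 0)

/-- `π ⊗ I`: an operator acting on subsystems AB only. -/
def opAB (π : Matrix Q4 Q4 ℂ) : Matrix Q3 Q3 ℂ :=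
  fun x y => π (x.1, x.2.1) (y.1, y.2.1) * (if x.2.2 = y.2.2 then (1 : ℂ) else 0)

/-- Outcome probability `pⱼ = Tr((I⊗πⱼ⊗I)ρ)` for measurement of B in basis `u`. -/
def pB (ρ : Matrix Q3 Q3 ℂ) (u : Fin 2 → Q2 → ℂ) (j : Fin 2) : ℝ :=
  ((opB (proj (u j)) * ρ).trace).re

/-- Conditional state of A given outcome `j` of the measurement on B. -/
def condA (ρ : Matrix Q3 Q3 ℂ) (u : Fin 2 → Q2 → ℂ) (j : Fin 2) : Matrix Q2 Q2 ℂ :=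
  ((pB ρ u j : ℂ))⁻¹ • rhoA (opB (proj (u j)) * ρ * opB (proj (u j)))

/-- Average conditional entropy `S(ρ_{A|Π^B}) = ∑_{j : pⱼ>0} pⱼ S(ρ_{A|j})`. -/
def SAcondB (ρ : Matrix Q3 Q3 ℂ) (u : Fin 2 → Q2 → ℂ) : ℝ :=
  ∑ j, if 0 < pB ρ u j then pB ρ u j * vN (condA ρ u j) else 0

/-- Outcome probability `pⱼ = Tr((πⱼ⊗I)ρ)` for measurement of AB in basis `v`. -/
def pAB (ρ : Matrix Q3 Q3 ℂ) (v : Fin 4 → Q4 → ℂ) (j : Fin 4) : ℝ :=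
  ((opAB (proj (v j)) * ρ).trace).re

/-- Conditional state of C given outcome `j` of the measurement on AB. -/
def condC (ρ : Matrix Q3 Q3 ℂ) (v : Fin 4 → Q4 → ℂ) (j : Fin 4) : Matrix Q2 Q2 ℂ :=
  ((pAB ρ v j : ℂ))⁻¹ • rhoC (opAB (proj (v j)) * ρ * opAB (proj (v j)))

/-- Average conditional entropy `S(ρ_{C|Π^{AB}}) = ∑_{j : pⱼ>0} pⱼ S(ρ_{C|j})`. -/
def SCcondAB (ρ : Matrix Q3 Q3 ℂ) (v : Fin 4 → Q4 → ℂ) : ℝ :=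
  ∑ j, if 0 < pAB ρ v j then pAB ρ v j * vN (condC ρ v j) else 0

/-- `𝓘₀(A:B:C)`: mutual information with no measurement. -/
def I0 (ρ : Matrix Q3 Q3 ℂ) : ℝ :=
  vN (rhoA ρ) + vN (rhoB ρ) + vN (rhoC ρ)
    - (vN (rhoAB ρ) + vN (rhoBC ρ) + vN (rhoAC ρ)) + vN ρ

/-- `𝓘₁(A:B:C)`: mutual information after one-particle measurement on B. -/
def I1 (ρ : Matrix Q3 Q3 ℂ) (u : Fin 2 → Q2 → ℂ) : ℝ :=
  vN (rhoA ρ) + vN (rhoC ρ) - SAcondB ρ u - vN (rhoAC ρ) - vN (rhoBC ρ) + vN ρ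

/-- `𝓘₂(A:B:C)`: mutual information after two-particle measurement on AB. -/
def I2 (ρ : Matrix Q3 Q3 ℂ) (v : Fin 4 → Q4 → ℂ) : ℝ :=
  vN (rhoA ρ) + vN (rhoB ρ) + vN (rhoC ρ) - (vN (rhoBC ρ) + vN (rhoAC ρ)) + SCcondAB ρ v

/-- Residual correlation function `D_RC = 𝓘₂ - 𝓘₁`. -/
def DRC (ρ : Matrix Q3 Q3 ℂ) (u : Fin 2 → Q2 → ℂ) (v : Fin 4 → Q4 → ℂ) : ℝ :=
  I2 ρ v - I1 ρ u

/-- The entropy of a positive semidefinite matrix of unit trace is nonnegative. -/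
theorem IsDensityMatrix.vN_nonneg {n : Type*} [Fintype n] [DecidableEq n] {ρ : Matrix n n ℂ}
    (hρ : IsDensityMatrix ρ) : 0 ≤ vN ρ := by
  obtain ⟨hpos, htr⟩ := hρ
  have hH := hpos.isHermitian
  have hsum : ∑ i, hH.eigenvalues i = 1 := by
    have h := hH.trace_eq_sum_eigenvalues
    rw [htr] at h
    simpa using (congrArg Complex.re h).symm
  rw [vN, dif_pos hH]
  refine Finset.sum_nonneg fun i _ => Real.negMulLog_nonneg (hpos.eigenvalues_nonneg i) ?_
  rw [← hsum]
  exact Finset.single_le_sum (fun j _ => hpos.eigenvalues_nonneg j) (Finset.mem_univ i)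

/-- An orthogonal projection has zero entropy. -/
theorem vN_eq_zero_of_mul_self {n : Type*} [Fintype n] [DecidableEq n] {P : Matrix n n ℂ}
    (hP : P * P = P) : vN P = 0 := by
  unfold vN
  split_ifs with hH
  · refine Finset.sum_eq_zero fun i _ => ?_
    have hv := hH.mulVec_eigenvectorBasis i
    have hne : (hH.eigenvectorBasis i : n → ℂ) ≠ 0 := fun h =>
      hH.eigenvectorBasis.orthonormal.ne_zero i (by ext k; exact congrFun h k)
    have h2 : P *ᵥ (P *ᵥ (hH.eigenvectorBasis i : n → ℂ)) =
        P *ᵥ (hH.eigenvectorBasis i : n → ℂ) := by rw [mulVec_mulVec, hP]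
    rw [hv, mulVec_smul, hv, smul_smul] at h2
    have h3 : hH.eigenvalues i * hH.eigenvalues i = hH.eigenvalues i :=
      smul_left_injective ℝ hne h2
    rcases IsIdempotentElem.iff_eq_zero_or_one.mp h3 with h | h <;> simp [h]
  · rfl

theorem proj_eq_vecMulVec {n : Type*} (w : n → ℂ) : proj w = vecMulVec w (star w) := rfl

theorem proj_posSemidef {n : Type*} [Fintype n] (w : n → ℂ) : (proj w).PosSemidef :=
  posSemidef_vecMulVec_self_star w

theorem IsUnitVec.proj_mul_self {n : Type*} [Fintype n] {w : n → ℂ} (hw : IsUnitVec w) :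
    proj w * proj w = proj w := by
  rw [proj_eq_vecMulVec, vecMulVec_mul_vecMulVec,
    show star w ⬝ᵥ w = 1 from hw, one_smul]

theorem IsUnitVec.isDensityMatrix_proj {n : Type*} [Fintype n] [DecidableEq n] {w : n → ℂ}
    (hw : IsUnitVec w) : IsDensityMatrix (proj w) :=
  ⟨proj_posSemidef w, by
    rw [proj_eq_vecMulVec, trace_vecMulVec, dotProduct_comm]; exact hw⟩

theorem OrthonormalFamily.isUnitVec {ι n : Type*} [DecidableEq ι] [Fintype n] {u : ι → n → ℂ}
    (hu : OrthonormalFamily u) (j : ι) : IsUnitVec (u j) :=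
  (hu j j).trans (if_pos rfl)

/-! ### Partial traces -/

theorem rhoA_posSemidef {M : Matrix Q3 Q3 ℂ} (hM : M.PosSemidef) : (rhoA M).PosSemidef := by
  have h : rhoA M = ∑ b, ∑ c, M.submatrix (fun a => (a, b, c)) (fun a => (a, b, c)) := by
    ext a a'; simp [rhoA, Matrix.sum_apply]
  rw [h]
  exact posSemidef_sum _ fun b _ => posSemidef_sum _ fun c _ => hM.submatrix _

theorem rhoB_posSemidef {M : Matrix Q3 Q3 ℂ} (hM : M.PosSemidef) : (rhoB M).PosSemidef := by
  have h : rhoB M = ∑ a, ∑ c, M.submatrix (fun b => (a, b, c)) (fun b => (a, b, c)) := by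
    ext b b'; simp [rhoB, Matrix.sum_apply]
  rw [h]
  exact posSemidef_sum _ fun a _ => posSemidef_sum _ fun c _ => hM.submatrix _

theorem rhoC_posSemidef {M : Matrix Q3 Q3 ℂ} (hM : M.PosSemidef) : (rhoC M).PosSemidef := by
  have h : rhoC M = ∑ a, ∑ b, M.submatrix (fun c => (a, b, c)) (fun c => (a, b, c)) := by
    ext c c'; simp [rhoC, Matrix.sum_apply]
  rw [h]
  exact posSemidef_sum _ fun a _ => posSemidef_sum _ fun b _ => hM.submatrix _

theorem trace_rhoA (M : Matrix Q3 Q3 ℂ) : (rhoA M).trace = M.trace := by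
  simp [rhoA, Matrix.trace, Fintype.sum_prod_type]

theorem trace_rhoB (M : Matrix Q3 Q3 ℂ) : (rhoB M).trace = M.trace := by
  simp only [rhoB, Matrix.trace, Matrix.diag_apply, Fintype.sum_prod_type]
  exact Finset.sum_comm

theorem trace_rhoC (M : Matrix Q3 Q3 ℂ) : (rhoC M).trace = M.trace := by
  simp only [rhoC, Matrix.trace, Matrix.diag_apply, Fintype.sum_prod_type]
  rw [Finset.sum_comm]
  exact Finset.sum_congr rfl fun a _ => Finset.sum_comm

/-! ### Local operators -/

theorem opB_mul (π σ : Matrix Q2 Q2 ℂ) : opB π * opB σ = opB (π * σ) := by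
  ext ⟨a, b, c⟩ ⟨a', b', c'⟩
  simp [opB, Matrix.mul_apply, Fintype.sum_prod_type]

theorem opAB_mul (π σ : Matrix Q4 Q4 ℂ) : opAB π * opAB σ = opAB (π * σ) := by
  ext ⟨a, b, c⟩ ⟨a', b', c'⟩
  simp [opAB, Matrix.mul_apply, Fintype.sum_prod_type]

theorem opB_isHermitian {π : Matrix Q2 Q2 ℂ} (hπ : π.IsHermitian) : (opB π).IsHermitian := by
  ext ⟨a, b, c⟩ ⟨a', b', c'⟩
  have h := hπ.apply b b'
  simp only [opB, conjTranspose_apply, star_mul', h, eq_comm (a := a'), eq_comm (a := c')]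
  split_ifs <;> simp

theorem opAB_isHermitian {π : Matrix Q4 Q4 ℂ} (hπ : π.IsHermitian) : (opAB π).IsHermitian := by
  ext ⟨a, b, c⟩ ⟨a', b', c'⟩
  have h := hπ.apply (a, b) (a', b')
  simp only [opAB, conjTranspose_apply, star_mul', h, eq_comm (a := c')]
  split_ifs <;> simp

/-! ### States after a projective measurement -/

theorem trace_projection_sandwich {n : Type*} [Fintype n] {P : Matrix n n ℂ} (hP : P * P = P)
    (ρ : Matrix n n ℂ) : (P * ρ * P).trace = (P * ρ).trace := by
  rw [trace_mul_comm, ← Matrix.mul_assoc, hP]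

theorem posSemidef_projection_sandwich {n : Type*} [Fintype n] {P ρ : Matrix n n ℂ}
    (hP : P.IsHermitian) (hρ : ρ.PosSemidef) : (P * ρ * P).PosSemidef := by
  simpa only [hP.eq] using hρ.mul_mul_conjTranspose_same P

/-- Normalizing a positive semidefinite matrix of positive trace gives a density matrix. -/
theorem isDensityMatrix_inv_smul {n : Type*} [Fintype n] [DecidableEq n] {M : Matrix n n ℂ}
    (hM : M.PosSemidef) {p : ℝ} (hp : 0 < p) (htr : M.trace.re = p) :
    IsDensityMatrix ((p : ℂ)⁻¹ • M) := by
  have hpC : (0 : ℂ) < p := by exact_mod_cast hp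
  have hMp : M.trace = p := by
    rw [← htr]
    exact (Complex.eq_re_of_ofReal_le (r := 0) (by simpa using hM.trace_nonneg))
  exact ⟨hM.smul (inv_nonneg.mpr hpC.le), by
    rw [trace_smul, hMp, smul_eq_mul, inv_mul_cancel₀ hpC.ne']⟩

theorem isDensityMatrix_condA {ρ : Matrix Q3 Q3 ℂ} (hρ : ρ.PosSemidef) {u : Fin 2 → Q2 → ℂ}
    (hu : OrthonormalFamily u) {j : Fin 2} (hj : 0 < pB ρ u j) :
    IsDensityMatrix (condA ρ u j) := by
  have hP : opB (proj (u j)) * opB (proj (u j)) = opB (proj (u j)) := by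
    rw [opB_mul, (hu.isUnitVec j).proj_mul_self]
  refine isDensityMatrix_inv_smul (rhoA_posSemidef (posSemidef_projection_sandwich
    (opB_isHermitian (proj_posSemidef _).isHermitian) hρ)) hj ?_
  rw [trace_rhoA, trace_projection_sandwich hP, pB]

theorem isDensityMatrix_condC {ρ : Matrix Q3 Q3 ℂ} (hρ : ρ.PosSemidef) {v : Fin 4 → Q4 → ℂ}
    (hv : OrthonormalFamily v) {j : Fin 4} (hj : 0 < pAB ρ v j) :
    IsDensityMatrix (condC ρ v j) := by
  have hP : opAB (proj (v j)) * opAB (proj (v j)) = opAB (proj (v j)) := by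
    rw [opAB_mul, (hv.isUnitVec j).proj_mul_self]
  refine isDensityMatrix_inv_smul (rhoC_posSemidef (posSemidef_projection_sandwich
    (opAB_isHermitian (proj_posSemidef _).isHermitian) hρ)) hj ?_
  rw [trace_rhoC, trace_projection_sandwich hP, pAB]

theorem SAcondB_nonneg {ρ : Matrix Q3 Q3 ℂ} (hρ : ρ.PosSemidef) {u : Fin 2 → Q2 → ℂ}
    (hu : OrthonormalFamily u) : 0 ≤ SAcondB ρ u := by
  refine Finset.sum_nonneg fun j _ => ?_
  split_ifs with hj
  · exact mul_nonneg hj.le (isDensityMatrix_condA hρ hu hj).vN_nonneg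
  · exact le_rfl

theorem SCcondAB_nonneg {ρ : Matrix Q3 Q3 ℂ} (hρ : ρ.PosSemidef) {v : Fin 4 → Q4 → ℂ}
    (hv : OrthonormalFamily v) : 0 ≤ SCcondAB ρ v := by
  refine Finset.sum_nonneg fun j _ => ?_
  split_ifs with hj
  · exact mul_nonneg hj.le (isDensityMatrix_condC hρ hv hj).vN_nonneg
  · exact le_rfl

/-- For a pure three-qubit state `ρ = |ψ⟩⟨ψ|` and every choice of orthonormal
measurement bases on B and on AB, the residual correlation function is nonnegative:
`D_RC(A:B:C) ≥ 0`. -/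
theorem residual_correlation_nonneg_pure_state
    (ψ : Q3 → ℂ) (hψ : IsUnitVec ψ)
    (u : Fin 2 → Q2 → ℂ) (hu : OrthonormalFamily u)
    (v : Fin 4 → Q4 → ℂ) (hv : OrthonormalFamily v) :
    0 ≤ SCcondAB (proj ψ) v - vN (proj ψ) + vN (rhoB (proj ψ)) + SAcondB (proj ψ) u := by
  have hρ := hψ.isDensityMatrix_proj
  have hC := SCcondAB_nonneg hρ.1 hv
  have hA := SAcondB_nonneg hρ.1 hu
  have hB : 0 ≤ vN (rhoB (proj ψ)) :=
    IsDensityMatrix.vN_nonneg ⟨rhoB_posSemidef hρ.1, (trace_rhoB _).trans hρ.2⟩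
  rw [vN_eq_zero_of_mul_self hψ.proj_mul_self]
  linarith
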